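/- Let (X,T) be a Polish dynamical system with the asymptotic orbital average shadowing property. Then for every non-empty compact connected subset V of M_T(X) there exists a point x ∈ X such that the set V_T(x) of weak* limit points of the empirical measures m_T(x,n) = (1/n)Σ_{i=0}^{n-1} δ_{T^i x} equals V. -/

import Mathlib

open MeasureTheory Filter Topology
open scoped ENNReal NNReal

section Defs

variable {X : Type*} [MetricSpace X] [MeasurableSpace X] [BorelSpace X]

/-- Kantorovich–Rubinshtein (dual-Lipschitz) distance between two measures:
the supremum of `|∫ f dμ - ∫ f dν|` over bounded `f` with Lipschitz constant at most `1`. -/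
noncomputable def krDist (μ ν : Measure X) : ℝ :=
  sSup { r : ℝ | ∃ f : X → ℝ, LipschitzWith 1 f ∧ (∃ C, ∀ x, |f x| ≤ C) ∧
    r = |∫ x, f x ∂μ - ∫ x, f x ∂ν| }

/-- Empirical measure of the first `n` terms of a sequence (as a plain measure). -/
noncomputable def empMeas (x : ℕ → X) (n : ℕ) : Measure X :=
  (n : ℝ≥0∞)⁻¹ • ∑ i ∈ Finset.range n, Measure.dirac (x i)

/-- Average of the Dirac measures at the first `max n 1` points of a sequence, as a
probability measure.  For `n ≥ 1` this is the `n`-th empirical measure. -/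
noncomputable def avgDirac (x : ℕ → X) (n : ℕ) : ProbabilityMeasure X :=
  ⟨((max n 1 : ℕ) : ℝ≥0∞)⁻¹ • ∑ i ∈ Finset.range (max n 1), Measure.dirac (x i), by
    constructor
    have h : (∑ i ∈ Finset.range (max n 1), Measure.dirac (x i)) Set.univ
        = ((max n 1 : ℕ) : ℝ≥0∞) := by
      simp [Measure.finset_sum_apply]
    rw [Measure.smul_apply, h, smul_eq_mul]
    exact ENNReal.inv_mul_cancel (by simp) (by simp)⟩

/-- The set of weak* limit points of the empirical measures of a sequence. -/
def limitMeasures (x : ℕ → X) : Set (ProbabilityMeasure X) :=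
  { μ | ∃ φ : ℕ → ℕ, StrictMono φ ∧ Tendsto (fun k => avgDirac x (φ k)) atTop (𝓝 μ) }

/-- `x` is a generic point for `μ`: the empirical measures along the orbit of `x`
converge to `μ` in the weak* topology. -/
def genericFor (T : X → X) (x : X) (μ : ProbabilityMeasure X) : Prop :=
  Tendsto (fun n => avgDirac (fun i => T^[i] x) n) atTop (𝓝 μ)

/-- The invariant measure supported on the periodic orbit of `x` of period `p`. -/
noncomputable def periodicOrbitMeasure (T : X → X) (x : X) (p : ℕ) : ProbabilityMeasure X :=
  avgDirac (fun i => T^[i] x) p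

/-- The set of invariant measures supported on periodic orbits of points of `K`. -/
def perMeasures (T : X → X) (K : Set X) : Set (ProbabilityMeasure X) :=
  { μ | ∃ x ∈ K, ∃ p, 0 < p ∧ T^[p] x = x ∧ μ = periodicOrbitMeasure T x p }

/-- The mean orbital pseudo-metric `Ē`. -/
noncomputable def meanOrbitalDist (T : X → X) (x y : X) : ℝ :=
  limsup (fun n => ⨅ σ : Equiv.Perm (Fin n),
    (∑ i : Fin n, dist (T^[(i : ℕ)] x) (T^[((σ i : Fin n) : ℕ)] y)) / n) atTop

/-- `x` is an asymptotic average pseudo-orbit for `T`. -/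
def IsAAPO (T : X → X) (x : ℕ → X) : Prop :=
  Tendsto (fun n => (∑ i ∈ Finset.range n, dist (T (x i)) (x (i + 1))) / n) atTop (𝓝 0)

/-- The point `x` is `K`-closable. -/
def ClosableAt (T : X → X) (K : Set X) (x : X) : Prop :=
  ∀ ε > (0 : ℝ), ∀ N : ℕ, ∃ p q : ℕ, 0 < p ∧ N ≤ p ∧ p ≤ q ∧ (q : ℝ) ≤ (1 + ε) * p ∧
    ∃ y ∈ K, T^[q] y = y ∧ ∀ i < p, dist (T^[i] y) (T^[i] x) < ε

/-- The set `K ⊆ Per(T)` is linkable. -/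
def Linkable (T : X → X) (K : Set X) : Prop :=
  ∀ y₁ ∈ K, ∀ y₂ ∈ K, ∀ ε > (0 : ℝ), ∀ lam ∈ Set.Icc (0 : ℝ) 1,
    ∃ p₁ p₂ q₁ q₂ : ℕ, 0 < p₁ ∧ 0 < p₂ ∧ T^[p₁] y₁ = y₁ ∧ T^[p₂] y₂ = y₂ ∧
      ∃ z ∈ K, T^[q₂] z = z ∧
        lam - ε ≤ (p₁ : ℝ) / (p₁ + p₂) ∧ (p₁ : ℝ) / (p₁ + p₂) ≤ lam + ε ∧
        p₁ ≤ q₁ ∧ (q₁ : ℝ) ≤ (1 + ε) * p₁ ∧ (∀ i < p₁, dist (T^[i] z) (T^[i] y₁) < ε) ∧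
        p₂ ≤ q₂ - q₁ ∧ ((q₂ - q₁ : ℕ) : ℝ) ≤ (1 + ε) * p₂ ∧
        (∀ i < p₂, dist (T^[i + q₁] z) (T^[i] y₂) < ε)

/-- `(X,T)` has the asymptotic orbital average shadowing property. -/
def AOASP (T : X → X) : Prop :=
  ∀ x : ℕ → X, IsAAPO T x → ∃ z : X,
    Tendsto (fun n => ⨅ σ : Equiv.Perm (Fin n),
      (∑ i : Fin n, dist (x (i : ℕ)) (T^[((σ i : Fin n) : ℕ)] z)) / n) atTop (𝓝 0)

end Defs


section MeasureCloseness

variable {X : Type*} [MetricSpace X] [MeasurableSpace X]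

/-- Two probability measures are `ε`-close if the integrals of every `1`-Lipschitz function with
values in `[-1, 1]` differ by at most `ε`. -/
def LipClose (ε : ℝ) (μ ν : ProbabilityMeasure X) : Prop :=
  ∀ f : X → ℝ, LipschitzWith 1 f → (∀ x, |f x| ≤ 1) → |∫ x, f x ∂μ - ∫ x, f x ∂ν| ≤ ε

lemma LipClose.refl {ε : ℝ} (hε : 0 ≤ ε) (μ : ProbabilityMeasure X) : LipClose ε μ μ := by
  intro f _ _
  simpa using hε

lemma LipClose.symm {ε : ℝ} {μ ν : ProbabilityMeasure X} (h : LipClose ε μ ν) :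
    LipClose ε ν μ := by
  intro f hf hf'
  rw [abs_sub_comm]
  exact h f hf hf'

lemma LipClose.trans {ε δ : ℝ} {μ ν κ : ProbabilityMeasure X} (h : LipClose ε μ ν)
    (h' : LipClose δ ν κ) : LipClose (ε + δ) μ κ := by
  intro f hf hf'
  exact (abs_sub_le _ (∫ x, f x ∂ν) _).trans (add_le_add (h f hf hf') (h' f hf hf'))

lemma LipClose.mono {ε δ : ℝ} (hεδ : ε ≤ δ) {μ ν : ProbabilityMeasure X} (h : LipClose ε μ ν) :
    LipClose δ μ ν :=
  fun f hf hf' => (h f hf hf').trans hεδ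

variable [BorelSpace X]

lemma tendsto_of_eventually_lipClose {u : ℕ → ProbabilityMeasure X} {μ : ProbabilityMeasure X}
    (h : ∀ ε > 0, ∀ᶠ n in atTop, LipClose ε (u n) μ) : Tendsto u atTop (𝓝 μ) := by
  rw [tendsto_iff_forall_lipschitz_integral_tendsto]
  rintro f ⟨C, hC⟩ ⟨L, hL⟩
  obtain ⟨x₀⟩ := μ.nonempty
  have hbd : ∀ x, |f x| ≤ C + |f x₀| := fun x => by
    have h1 := hC x x₀
    rw [Real.dist_eq] at h1
    have h2 := abs_sub_abs_le_abs_sub (f x) (f x₀)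
    linarith
  have hC0 : 0 ≤ C := by simpa using hC x₀ x₀
  set M : ℝ := L + (C + |f x₀|) + 1 with hM
  have hMpos : 0 < M := by positivity
  have hg : LipschitzWith 1 (fun x => M⁻¹ * f x) := by
    refine LipschitzWith.of_dist_le_mul fun x y => ?_
    have h1 := hL.dist_le_mul x y
    rw [Real.dist_eq] at h1 ⊢
    rw [← mul_sub, abs_mul, abs_of_pos (inv_pos.2 hMpos), inv_mul_le_iff₀ hMpos]
    have : (L : ℝ) * dist x y ≤ M * dist x y := by
      gcongr
      rw [hM]
      have := abs_nonneg (f x₀)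
      linarith
    simpa using h1.trans this
  have hg' : ∀ x, |M⁻¹ * f x| ≤ 1 := fun x => by
    rw [abs_mul, abs_of_pos (inv_pos.2 hMpos), inv_mul_le_iff₀ hMpos, mul_one]
    have := hbd x
    have := L.coe_nonneg
    linarith
  rw [Metric.tendsto_nhds]
  intro ε hε
  filter_upwards [h (ε / (2 * M)) (by positivity)] with n hn
  have h1 := hn _ hg hg'
  rw [integral_const_mul, integral_const_mul, ← mul_sub, abs_mul, abs_of_pos (inv_pos.2 hMpos),
    inv_mul_le_iff₀ hMpos] at h1
  rw [Real.dist_eq]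
  have : M * (ε / (2 * M)) = ε / 2 := by field_simp
  linarith

lemma integral_le_of_levyProkhorovEDist_lt_of_lipschitz {μ ν : Measure X} [IsProbabilityMeasure μ]
    [IsProbabilityMeasure ν] {ε : ℝ} (hε : 0 < ε)
    (h : levyProkhorovEDist μ ν < ENNReal.ofReal ε) {f : X → ℝ} (hf : LipschitzWith 1 f)
    (hf' : ∀ x, |f x| ≤ 1) : ∫ x, f x ∂μ ≤ ∫ x, f x ∂ν + 3 * ε := by
  let F : BoundedContinuousFunction X ℝ :=
    BoundedContinuousFunction.ofNormedAddCommGroup f hf.continuous 1 hf'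
  let one : BoundedContinuousFunction X ℝ := BoundedContinuousFunction.const X 1
  let G : BoundedContinuousFunction X ℝ := F + one
  let H : BoundedContinuousFunction X ℝ := G + BoundedContinuousFunction.const X ε
  have hG : ∀ x, G x = f x + 1 := fun x => rfl
  have hH : ∀ x, H x = G x + ε := fun x => rfl
  have hG0 : ∀ x, 0 ≤ G x := fun x => by
    rw [hG]
    have := (abs_le.1 (hf' x)).1
    linarith
  have hH0 : ∀ x, 0 ≤ H x := fun x => by
    rw [hH]
    have := hG0 x
    linarith
  have hGn : ‖G‖ ≤ 2 := by
    refine (BoundedContinuousFunction.norm_le (by norm_num)).2 fun x => ?_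
    rw [Real.norm_eq_abs, abs_of_nonneg (hG0 x), hG]
    have := (abs_le.1 (hf' x)).2
    linarith
  have hGH : ‖G‖ ≤ ‖H‖ := by
    refine (BoundedContinuousFunction.norm_le (norm_nonneg _)).2 fun x => ?_
    refine le_trans ?_ (H.norm_coe_le_norm x)
    rw [Real.norm_eq_abs, Real.norm_eq_abs, abs_of_nonneg (hG0 x), abs_of_nonneg (hH0 x), hH]
    linarith
  have key := BoundedContinuousFunction.integral_le_of_levyProkhorovEDist_lt μ ν hε h G
    (Eventually.of_forall hG0)
  have hsub : ∀ t : ℝ, Metric.thickening ε {a | t ≤ G a} ⊆ {a | t ≤ H a} := by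
    intro t a ha
    obtain ⟨b, hb, hab⟩ := Metric.mem_thickening_iff.1 ha
    have h1 := hf.dist_le_mul a b
    rw [Real.dist_eq] at h1
    have h2 := (abs_le.1 h1).1
    simp only [Set.mem_ofPred_eq, hH, hG, NNReal.coe_one, one_mul] at *
    linarith
  have int₁ : IntegrableOn (fun t => ν.real (Metric.thickening ε {a | t ≤ G a}))
      (Set.Ioc 0 ‖G‖) := by
    apply Measure.integrableOn_of_bounded (M := 1) measure_Ioc_lt_top.ne
    · apply (Measurable.ennreal_toReal (Antitone.measurable ?_)).aestronglyMeasurable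
      exact fun _ _ hst =>
        measure_mono <| Metric.thickening_subset_of_subset ε (fun _ h ↦ hst.trans h)
    · refine Eventually.of_forall fun t => ?_
      simp only [Real.norm_eq_abs, abs_of_nonneg measureReal_nonneg]
      exact measureReal_le_one
  have int₂ : IntegrableOn (fun t => ν.real {a | t ≤ H a}) (Set.Ioc 0 ‖H‖) := by
    apply Measure.integrableOn_of_bounded (M := 1) measure_Ioc_lt_top.ne
    · apply (Measurable.ennreal_toReal (Antitone.measurable ?_)).aestronglyMeasurable
      exact fun _ _ hst => measure_mono (fun _ h ↦ hst.trans h)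
    · refine Eventually.of_forall fun t => ?_
      simp only [Real.norm_eq_abs, abs_of_nonneg measureReal_nonneg]
      exact measureReal_le_one
  have step₁ : ∫ t in Set.Ioc 0 ‖G‖, ν.real (Metric.thickening ε {a | t ≤ G a})
      ≤ ∫ t in Set.Ioc 0 ‖H‖, ν.real {a | t ≤ H a} := by
    calc _ ≤ ∫ t in Set.Ioc 0 ‖G‖, ν.real {a | t ≤ H a} :=
          setIntegral_mono int₁ (int₂.mono_set (Set.Ioc_subset_Ioc_right hGH))
            fun t => measureReal_mono (hsub t)
      _ ≤ _ := setIntegral_mono_set int₂ (Eventually.of_forall fun _ => measureReal_nonneg)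
            (Set.Ioc_subset_Ioc_right hGH).eventuallyLE
  rw [← BoundedContinuousFunction.integral_eq_integral_meas_le H ν (Eventually.of_forall hH0)]
    at step₁
  have eG : ∫ x, G x ∂μ = ∫ x, f x ∂μ + 1 := by
    simp only [hG]
    have hi : Integrable f μ := F.integrable μ
    rw [integral_add hi (integrable_const _)]
    simp
  have eH : ∫ x, H x ∂ν = ∫ x, f x ∂ν + 1 + ε := by
    simp only [hH, hG]
    have hi : Integrable f ν := F.integrable ν
    have hi' : Integrable (fun x => f x + 1) ν := hi.add (integrable_const _)
    rw [integral_add hi' (integrable_const _), integral_add hi (integrable_const _)]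
    simp
  rw [eG] at key
  rw [eH] at step₁
  nlinarith

lemma eventually_lipClose [TopologicalSpace.SeparableSpace X] (μ : ProbabilityMeasure X) {ε : ℝ}
    (hε : 0 < ε) : ∀ᶠ ν in 𝓝 μ, LipClose ε μ ν := by
  have h := (LevyProkhorov.continuous_ofMeasure_probabilityMeasure (Ω := X)).tendsto μ
  have h' : ∀ᶠ ν in 𝓝 μ, edist (LevyProkhorov.ofMeasure ν) (LevyProkhorov.ofMeasure μ)
      < ENNReal.ofReal (ε / 3) :=
    h.eventually (Metric.eball_mem_nhds _ (by simpa using hε))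
  filter_upwards [h'] with ν hν f hf hf'
  rw [LevyProkhorov.edist_probabilityMeasure_def] at hν
  have hν' := hν
  rw [levyProkhorovEDist_comm] at hν'
  have h1 := integral_le_of_levyProkhorovEDist_lt_of_lipschitz (by positivity) hν hf hf'
  have h2 := integral_le_of_levyProkhorovEDist_lt_of_lipschitz (by positivity) hν' hf hf'
  rw [abs_le]
  constructor <;> linarith

lemma integral_avgDirac (x : ℕ → X) {n : ℕ} (hn : 0 < n) {f : X → ℝ} (hf : Continuous f) :
    ∫ a, f a ∂(avgDirac x n : Measure X) = (∑ i ∈ Finset.range n, f (x i)) / n := by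
  have hm : max n 1 = n := max_eq_left hn
  have : (avgDirac x n : Measure X)
      = (n : ℝ≥0∞)⁻¹ • ∑ i ∈ Finset.range n, Measure.dirac (x i) := by
    unfold avgDirac
    rw [ProbabilityMeasure.coe_mk, hm]
  rw [this, integral_smul_measure, integral_finsetSum_measure]
  · simp [integral_dirac' _ _ hf.stronglyMeasurable, div_eq_inv_mul]
  · intro i _
    exact integrable_dirac' hf.stronglyMeasurable (by simp)

lemma exists_finset_of_mem_nhds {μ : ProbabilityMeasure X} {S : Set (ProbabilityMeasure X)}
    (hS : S ∈ 𝓝 μ) : ∃ I : Finset (BoundedContinuousFunction X ℝ),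
      ∀ u : ℕ → ProbabilityMeasure X,
        (∀ f ∈ I, Tendsto (fun n => ∫ x, f x ∂(u n : Measure X)) atTop
          (𝓝 (∫ x, f x ∂(μ : Measure X)))) → ∀ᶠ n in atTop, u n ∈ S := by
  have h : Tendsto id (⨅ f : BoundedContinuousFunction X ℝ,
      comap (fun ν : ProbabilityMeasure X => ∫ x, f x ∂(ν : Measure X))
        (𝓝 (∫ x, f x ∂(μ : Measure X)))) (𝓝 μ) := by
    rw [ProbabilityMeasure.tendsto_iff_forall_integral_tendsto]
    exact fun f => tendsto_comap.mono_left (iInf_le _ f)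
  have hS' := h hS
  rw [mem_map, Set.preimage_id, mem_iInf] at hS'
  obtain ⟨I, hI, W, hW, rfl⟩ := hS'
  refine ⟨hI.toFinset, fun u hu => ?_⟩
  have : Finite I := hI
  simp only [Set.mem_iInter]
  rw [eventually_all]
  intro f
  exact (tendsto_comap_iff.2 (hu f (by simp))).eventually (hW f)

end MeasureCloseness

section AverageEstimates

/-- If the averages of a bounded sequence over the first blocks of length `N` tend to zero, then so
do its Cesàro averages. -/
lemma tendsto_average_of_tendsto_block_average {N : ℕ} (hN : 0 < N) {g : ℕ → ℝ} {B : ℝ}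
    (hB : ∀ i, |g i| ≤ B)
    (h : Tendsto (fun q : ℕ => (∑ i ∈ Finset.range (N * q), g i) / q) atTop (𝓝 0)) :
    Tendsto (fun n : ℕ => (∑ i ∈ Finset.range n, g i) / n) atTop (𝓝 0) := by
  have hB0 : 0 ≤ B := (abs_nonneg _).trans (hB 0)
  have hdiv : Tendsto (fun n : ℕ => n / N) atTop atTop := Nat.tendsto_div_const_atTop hN.ne'
  have h1 := (h.comp hdiv).abs
  have h2 : Tendsto (fun n : ℕ => B * N / (n : ℝ)) atTop (𝓝 0) :=
    tendsto_const_div_atTop_nhds_zero_nat _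
  have h3 := h1.add h2
  rw [abs_zero, add_zero] at h3
  refine squeeze_zero_norm' ?_ h3
  filter_upwards [eventually_ge_atTop N] with n hn
  have hn0 : (0 : ℝ) < n := by exact_mod_cast hN.trans_le hn
  have hq0 : (0 : ℝ) < (n / N : ℕ) := by exact_mod_cast Nat.div_pos hn hN
  have hqn : ((n / N : ℕ) : ℝ) ≤ n := by exact_mod_cast Nat.div_le_self n N
  have hsplit : ∑ i ∈ Finset.range n, g i = ∑ i ∈ Finset.range (N * (n / N)), g i
      + ∑ i ∈ Finset.range (n % N), g (N * (n / N) + i) := by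
    rw [← Finset.sum_range_add, Nat.div_add_mod]
  have hrest : |∑ i ∈ Finset.range (n % N), g (N * (n / N) + i)| ≤ B * N := by
    refine (Finset.abs_sum_le_sum_abs _ _).trans ((Finset.sum_le_sum fun i _ => hB _).trans ?_)
    rw [Finset.sum_const, Finset.card_range, nsmul_eq_mul, mul_comm]
    gcongr
    exact (Nat.mod_lt n hN).le
  rw [Real.norm_eq_abs, hsplit, add_div]
  refine (abs_add_le _ _).trans (add_le_add ?_ ?_)
  · simp only [Function.comp, abs_div, Nat.abs_cast]
    gcongr
  · rw [abs_div, Nat.abs_cast]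
    gcongr

lemma abs_sum_sub_le_of_eqOn_block {a b : ℕ → ℝ} {m : ℕ} {c D ε : ℝ} {N l : ℕ}
    (hε : 0 ≤ ε) (ha : ∀ i, |a i - c| ≤ D) (hb : ∀ i, |b i - c| ≤ D)
    (hN : ∀ t, N ≤ t → |∑ i ∈ Finset.range t, (b i - c)| ≤ ε * t)
    (hab : ∀ i, i + 1 < l → a (m + i) = b i) {t : ℕ} (ht : t ≤ l) :
    |∑ i ∈ Finset.range t, (a (m + i) - c)| ≤ D * N + ε * t + 2 * D := by
  have hD : 0 ≤ D := (abs_nonneg _).trans (ha 0)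
  have h1 : |∑ i ∈ Finset.range t, (b i - c)| ≤ D * N + ε * t := by
    rcases le_or_gt N t with h | h
    · have := hN t h
      have : 0 ≤ D * N := by positivity
      linarith
    · refine (Finset.abs_sum_le_sum_abs _ _).trans ((Finset.sum_le_sum fun i _ => hb i).trans ?_)
      rw [Finset.sum_const, Finset.card_range, nsmul_eq_mul, mul_comm]
      have : D * t ≤ D * N := by gcongr
      have : 0 ≤ ε * t := by positivity
      linarith
  have h2 : |∑ i ∈ Finset.range t, (a (m + i) - b i)| ≤ 2 * D := by
    rcases t with _ | u
    · simpa using hD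
    · rw [Finset.sum_range_succ, Finset.sum_eq_zero, zero_add]
      · calc |a (m + u) - b u| ≤ |a (m + u) - c| + |c - b u| := abs_sub_le _ _ _
          _ ≤ 2 * D := by
            rw [abs_sub_comm c]
            linarith [ha (m + u), hb u]
      · intro i hi
        rw [Finset.mem_range] at hi
        rw [hab i (by omega), sub_self]
  have h3 : ∑ i ∈ Finset.range t, (a (m + i) - c)
      = ∑ i ∈ Finset.range t, (a (m + i) - b i) + ∑ i ∈ Finset.range t, (b i - c) := by
    rw [← Finset.sum_add_distrib]
    exact Finset.sum_congr rfl fun i _ => by ring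
  rw [h3]
  linarith [abs_add_le (∑ i ∈ Finset.range t, (a (m + i) - b i)) (∑ i ∈ Finset.range t, (b i - c))]

/-- A sequence obtained by gluing long pieces of sequences with averages close to `c k` has averages
close to `c (k + 1)` along the `(k + 1)`-st piece. -/
lemma abs_sum_sub_le_of_blocks {a : ℕ → ℝ} {b : ℕ → ℕ → ℝ} {c : ℕ → ℝ} {D : ℝ} {N s : ℕ → ℕ}
    (ha : ∀ k i, |a i - c k| ≤ D) (hb : ∀ k i, |b k i - c k| ≤ D)
    (hN : ∀ k t, N k ≤ t → |∑ i ∈ Finset.range t, (b k i - c k)| ≤ 1 / ((k : ℝ) + 1) * t)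
    (hs : ∀ k, s k + (k + 1) * (s k + N k + N (k + 1) + 1) ≤ s (k + 1))
    (hab : ∀ k i, s k + i + 1 < s (k + 1) → a (s k + i) = b k i)
    {k : ℕ} {δ : ℝ} (hδ : |c k - c (k + 1)| ≤ δ) {n : ℕ} (hn : s (k + 1) ≤ n)
    (hn' : n ≤ s (k + 1 + 1)) :
    |∑ i ∈ Finset.range n, (a i - c (k + 1))| ≤ ((7 * D + 2) * (1 / ((k : ℝ) + 1)) + δ) * n := by
  have hD : 0 ≤ D := (abs_nonneg _).trans (ha 0 0)
  have hδ0 : 0 ≤ δ := (abs_nonneg _).trans hδ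
  set ε : ℝ := 1 / ((k : ℝ) + 1) with hε
  have hε0 : 0 < ε := by positivity
  have hε' : 1 / (((k + 1 : ℕ) : ℝ) + 1) ≤ ε := by
    rw [hε]
    gcongr
    simp
  have hε'0 : 0 ≤ 1 / (((k + 1 : ℕ) : ℝ) + 1) := by positivity
  obtain ⟨l, hl⟩ := Nat.exists_eq_add_of_le ((Nat.le_add_right _ _).trans (hs k))
  obtain ⟨l', hl'⟩ := Nat.exists_eq_add_of_le ((Nat.le_add_right _ _).trans (hs (k + 1)))
  obtain ⟨t, rfl⟩ := Nat.exists_eq_add_of_le hn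
  have hlen : (s k : ℝ) + N k + N (k + 1) + 1 ≤ ε * l := by
    have h1 := hs k
    rw [hl, add_le_add_iff_left] at h1
    have h2 : ((k : ℝ) + 1) * (s k + N k + N (k + 1) + 1) ≤ l := by exact_mod_cast h1
    rw [hε, one_div, le_inv_mul_iff₀ (by positivity)]
    exact h2
  have hls : (l : ℝ) ≤ s (k + 1) := by
    rw [hl]
    exact_mod_cast Nat.le_add_left _ _
  have hεs : ε * l ≤ ε * s (k + 1) := by gcongr
  have e1 := abs_sum_sub_le_of_eqOn_block (m := s k) hε0.le (ha k) (hb k) (hN k)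
    (fun i hi => hab k i (by omega)) le_rfl (l := l)
  have e2 := abs_sum_sub_le_of_eqOn_block (m := s (k + 1)) hε'0 (ha (k + 1)) (hb (k + 1))
    (hN (k + 1)) (fun i hi => hab (k + 1) i (by omega)) (l := l') (t := t) (by omega)
  have e0 : |∑ i ∈ Finset.range (s k), (a i - c (k + 1))| ≤ D * s k := by
    refine (Finset.abs_sum_le_sum_abs _ _).trans ((Finset.sum_le_sum fun i _ => ha _ i).trans ?_)
    rw [Finset.sum_const, Finset.card_range, nsmul_eq_mul, mul_comm]
  have e1' : |∑ i ∈ Finset.range l, (a (s k + i) - c (k + 1))|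
      ≤ D * N k + ε * l + 2 * D + δ * l := by
    have h : ∑ i ∈ Finset.range l, (a (s k + i) - c (k + 1))
        = ∑ i ∈ Finset.range l, (a (s k + i) - c k) + l * (c k - c (k + 1)) := by
      rw [← nsmul_eq_mul, ← Finset.card_range l, ← Finset.sum_const, Finset.card_range,
        ← Finset.sum_add_distrib]
      exact Finset.sum_congr rfl fun i _ => by ring
    rw [h]
    refine (abs_add_le _ _).trans (add_le_add e1 ?_)
    rw [abs_mul, Nat.abs_cast, mul_comm]
    gcongr
  have hsum : ∑ i ∈ Finset.range (s (k + 1) + t), (a i - c (k + 1))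
      = ∑ i ∈ Finset.range (s k), (a i - c (k + 1))
        + ∑ i ∈ Finset.range l, (a (s k + i) - c (k + 1))
        + ∑ i ∈ Finset.range t, (a (s (k + 1) + i) - c (k + 1)) := by
    rw [Finset.sum_range_add, hl, Finset.sum_range_add]
  have hmain : |∑ i ∈ Finset.range (s (k + 1) + t), (a i - c (k + 1))|
      ≤ D * s k + (D * N k + ε * l + 2 * D + δ * l)
        + (D * N (k + 1) + 1 / (((k + 1 : ℕ) : ℝ) + 1) * t + 2 * D) := by
    rw [hsum]
    exact (abs_add_le _ _).trans (add_le_add ((abs_add_le _ _).trans (add_le_add e0 e1')) e2)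
  have f1 : 1 / (((k + 1 : ℕ) : ℝ) + 1) * (t : ℝ) ≤ ε * t := by gcongr
  have f2 : D * (s k + N k + N (k + 1) + 1) ≤ D * (ε * s (k + 1)) := by
    gcongr
    exact hlen.trans hεs
  have f3 : D * 1 ≤ D * (ε * s (k + 1)) := by
    gcongr
    have : (0 : ℝ) ≤ s k + N k + N (k + 1) := by positivity
    linarith
  have f4 : δ * l ≤ δ * s (k + 1) := by gcongr
  have f5 : 0 ≤ D * (ε * t) := by positivity
  have f6 : 0 ≤ δ * t := by positivity
  have f7 : 0 ≤ ε * t := by positivity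
  have f8 : 0 ≤ D * (ε * s (k + 1)) := by positivity
  have f9 : 0 ≤ ε * s (k + 1) := by positivity
  refine hmain.trans ?_
  push_cast at *
  nlinarith

end AverageEstimates

section Gluing

/-- The sequence which agrees with the initial pieces of `c 0, c 1, c 2, …` placed at the
positions `s 0, s 1, s 2, …`. -/
def glue {α : Type*} (s : ℕ → ℕ) (c : ℕ → ℕ → α) (i : ℕ) : α :=
  c (Nat.findGreatest (fun j => s j ≤ i) i) (i - s (Nat.findGreatest (fun j => s j ≤ i) i))

lemma glue_apply {α : Type*} {s : ℕ → ℕ} (hs : StrictMono s) (c : ℕ → ℕ → α) {k t : ℕ}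
    (h : s k + t < s (k + 1)) : glue s c (s k + t) = c k t := by
  have : Nat.findGreatest (fun j => s j ≤ s k + t) (s k + t) = k := by
    rw [Nat.findGreatest_eq_iff]
    refine ⟨(hs.le_apply).trans (Nat.le_add_right _ _), fun _ => Nat.le_add_right _ _, ?_⟩
    intro j hj _
    have : s (k + 1) ≤ s j := hs.monotone (Nat.succ_le_of_lt hj)
    omega
  unfold glue
  rw [this, Nat.add_sub_cancel_left]

lemma exists_eq_add_of_strictMono {s : ℕ → ℕ} (hs : StrictMono s) (h0 : s 0 = 0) (n : ℕ) :
    ∃ k t, n = s k + t ∧ s k + t < s (k + 1) := by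
  induction n with
  | zero => exact ⟨0, 0, by simp [h0], by simpa using hs (Nat.lt_succ_self 0)⟩
  | succ n ih =>
    obtain ⟨k, t, rfl, h⟩ := ih
    rcases (Nat.succ_le_of_lt h).lt_or_eq with h' | h'
    · exact ⟨k, t + 1, by omega, by omega⟩
    · refine ⟨k + 1, 0, by omega, ?_⟩
      simpa using hs (Nat.lt_succ_self (k + 1))

lemma exists_chain_of_reflTransGen {α : Type*} {R : α → α → Prop} {a b : α} (hb : R b b)
    (h : Relation.ReflTransGen R a b) :
    ∃ (l : ℕ) (c : ℕ → α), 0 < l ∧ c 0 = a ∧ c l = b ∧ ∀ i < l, R (c i) (c (i + 1)) := by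
  induction h using Relation.ReflTransGen.head_induction_on with
  | refl => exact ⟨1, fun _ => b, one_pos, rfl, rfl, fun _ _ => hb⟩
  | @head a c hac _ ih =>
    obtain ⟨l, d, hl, h0, hl', hd⟩ := ih
    refine ⟨l + 1, fun i => Nat.casesOn i a d, by omega, rfl, hl', ?_⟩
    rintro (_ | i) hi
    · change R a (d 0)
      rwa [h0]
    · exact hd i (by omega)

/-- Chains joining the consecutive terms of a sequence can be concatenated. -/
lemma exists_seq_of_reflTransGen {α : Type*} {R : ℕ → α → α → Prop}
    {q : ℕ → α} (hq : ∀ j, R j (q (j + 1)) (q (j + 1)))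
    (h : ∀ j, Relation.ReflTransGen (R j) (q j) (q (j + 1))) :
    ∃ u : ℕ → α, (∀ i, ∃ j, R j (u i) (u (i + 1))) ∧
      (∀ j, ∀ᶠ i in atTop, ∃ j' ≥ j, R j' (u i) (u (i + 1))) ∧
      ∀ m, ∃ i ≥ m, u i = q m := by
  choose l c hl h0 hl' hc using fun j => exists_chain_of_reflTransGen (hq j) (h j)
  let s : ℕ → ℕ := fun k => ∑ j ∈ Finset.range k, l j
  have hs1 : ∀ k, s (k + 1) = s k + l k := fun k => Finset.sum_range_succ _ _
  have hs : StrictMono s := strictMono_nat_of_lt_succ fun k => by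
    have := hl k
    rw [hs1]
    omega
  have hglue : ∀ k t, t ≤ l k → glue s c (s k + t) = c k t := by
    intro k t ht
    rcases ht.lt_or_eq with ht | rfl
    · exact glue_apply hs c (by rw [hs1]; omega)
    · rw [← hs1, hl', ← h0 (k + 1)]
      exact glue_apply hs c (t := 0) (by simpa using hs (Nat.lt_succ_self (k + 1)))
  have hR : ∀ j, ∀ i ≥ s j, ∃ j' ≥ j, R j' (glue s c i) (glue s c (i + 1)) := by
    intro j i hi
    obtain ⟨k, t, rfl, hk⟩ := exists_eq_add_of_strictMono hs (by simp [s]) i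
    have ht : t < l k := by rw [hs1] at hk; omega
    refine ⟨k, ?_, ?_⟩
    · by_contra! hkj
      have : s (k + 1) ≤ s j := hs.monotone (Nat.succ_le_of_lt hkj)
      omega
    · rw [hglue k t ht.le, add_assoc, hglue k (t + 1) ht]
      exact hc k t ht
  refine ⟨glue s c, fun i => ?_, fun j => ?_, fun m => ⟨s m, hs.le_apply, ?_⟩⟩
  · obtain ⟨j, -, hj⟩ := hR 0 i (by simp [s])
    exact ⟨j, hj⟩
  · exact (eventually_ge_atTop (s j)).mono (hR j)
  · have := hglue m 0 (Nat.zero_le _)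
    rw [add_zero] at this
    rw [this, h0]

end Gluing

section PseudoOrbits

/-- Countably many integrable functions have a common sequence of sample points along which their
averages converge to their integrals. -/
lemma exists_seq_tendsto_average {X ι : Type*} [MeasurableSpace X] [Countable ι]
    (μ : ProbabilityMeasure X)
    {g : ι → X → ℝ} (hg : ∀ i, Measurable (g i)) (hi : ∀ i, Integrable (g i) (μ : Measure X)) :
    ∃ p : ℕ → X, ∀ i, Tendsto (fun n : ℕ => (∑ j ∈ Finset.range n, g i (p j)) / n) atTop
      (𝓝 (∫ x, g i x ∂(μ : Measure X))) := by
  let P : Measure (ℕ → X) := Measure.infinitePi fun _ => (μ : Measure X)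
  have hP : ∀ j, MeasurePreserving (fun ω : ℕ → X => ω j) P (μ : Measure X) := fun j =>
    measurePreserving_eval_infinitePi (fun _ => (μ : Measure X)) j
  have key : ∀ i, ∀ᵐ ω ∂P, Tendsto (fun n : ℕ => (∑ j ∈ Finset.range n, g i (ω j)) / n) atTop
      (𝓝 (∫ x, g i x ∂(μ : Measure X))) := by
    intro i
    have hind : ProbabilityTheory.iIndepFun (fun (j : ℕ) (ω : ℕ → X) => g i (ω j)) P :=
      ProbabilityTheory.iIndepFun_infinitePi (X := fun _ => g i) fun _ => hg i
    have hlaw := ProbabilityTheory.strong_law_ae_real (μ := P) (fun j ω => g i (ω j))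
      ((hP 0).integrable_comp_of_integrable (hi i)) (fun j k hjk => hind.indepFun hjk)
      (fun j => by
        have h0 : Measure.map (fun ω : ℕ → X => ω j) P = Measure.map (fun ω : ℕ → X => ω 0) P := by
          rw [(hP j).map_eq, (hP 0).map_eq]
        exact (ProbabilityTheory.IdentDistrib.mk (hP j).measurable.aemeasurable
          (hP 0).measurable.aemeasurable h0).comp (hg i))
    have hint : ∫ ω, g i (ω 0) ∂P = ∫ x, g i x ∂(μ : Measure X) := by
      rw [← (hP 0).map_eq, integral_map (hP 0).measurable.aemeasurable]
      rw [(hP 0).map_eq]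
      exact (hi i).aestronglyMeasurable
    rwa [hint] at hlaw
  exact (ae_all_iff.2 key).exists

variable {X : Type*} [MetricSpace X] [MeasurableSpace X] [BorelSpace X]

/-- Orbit segments of length `N` placed one after another form a pseudo-orbit with small average
error. -/
lemma sum_dist_segments_le {T : X → X} {C : ℝ} (hd : ∀ a b : X, dist a b ≤ C) {N : ℕ}
    (hN : 0 < N) (p : ℕ → X) (t : ℕ) :
    ∑ i ∈ Finset.range t, dist (T (T^[i % N] (p (i / N)))) (T^[(i + 1) % N] (p ((i + 1) / N)))
      ≤ C * (t / N : ℕ) := by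
  induction t with
  | zero => simp
  | succ t ih =>
    rw [Finset.sum_range_succ, Nat.succ_div]
    by_cases h : N ∣ t + 1
    · rw [if_pos h]
      push_cast
      rw [mul_add, mul_one]
      exact add_le_add ih (hd _ _)
    · have hmod : (t + 1) % N = t % N + 1 := by
        rw [Nat.add_mod_eq_ite]
        have hN1 : N ≠ 1 := by
          rintro rfl
          exact h (one_dvd _)
        rw [Nat.mod_eq_of_lt (show 1 < N by omega), if_neg]
        intro hle
        apply h
        have := Nat.mod_lt t hN
        have h2 : t % N + 1 = N := by omega
        refine ⟨t / N + 1, ?_⟩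
        have := Nat.div_add_mod t N
        rw [mul_add]
        omega
      rw [if_neg h, add_zero, hmod, Function.iterate_succ_apply',
        dist_self, add_zero]
      exact ih

/-- Every invariant measure is approximated by the averages along pseudo-orbits with arbitrarily
small average error. -/
lemma exists_pseudoOrbit_of_invariant {T : X → X} (hT : Continuous T) {C : ℝ}
    (hd : ∀ a b : X, dist a b ≤ C) {μ : ProbabilityMeasure X}
    (hμ : (μ : Measure X).map T = μ) {S : Set (ProbabilityMeasure X)} (hS : S ∈ 𝓝 μ) {ε : ℝ}
    (hε : 0 < ε) : ∃ y : ℕ → X, ∀ᶠ t : ℕ in atTop, avgDirac y t ∈ S ∧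
      ∑ i ∈ Finset.range t, dist (T (y i)) (y (i + 1)) ≤ ε * t := by
  obtain ⟨I, hI⟩ := exists_finset_of_mem_nhds hS
  obtain ⟨N, hN⟩ := exists_nat_gt (C / ε)
  obtain ⟨x₀⟩ := μ.nonempty
  have hC : 0 ≤ C := dist_nonneg.trans (hd x₀ x₀)
  have hN0 : 0 < N := by
    have : (0 : ℝ) < N := (div_nonneg hC hε.le).trans_lt hN
    exact_mod_cast this
  have hpres : MeasurePreserving T (μ : Measure X) (μ : Measure X) := ⟨hT.measurable, hμ⟩
  obtain ⟨p, hp⟩ := exists_seq_tendsto_average μ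
    (g := fun (fr : I × ℕ) x => (fr.1 : BoundedContinuousFunction X ℝ) (T^[fr.2] x))
    (fun fr => fr.1.1.continuous.measurable.comp (hT.iterate fr.2).measurable)
    (fun fr => (hpres.iterate fr.2).integrable_comp_of_integrable
      (fr.1.1.integrable (μ : Measure X)))
  refine ⟨fun i => T^[i % N] (p (i / N)), (hI _ fun f hf => ?_).and ?_⟩
  · set c := ∫ x, f x ∂(μ : Measure X) with hc
    have hp' : ∀ r : ℕ, Tendsto (fun n : ℕ => (∑ j ∈ Finset.range n, (f (T^[r] (p j)) - c)) / n)
        atTop (𝓝 0) := by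
      intro r
      have h1 := (hp (⟨f, hf⟩, r)).sub_const c
      have h2 : ∫ x, f (T^[r] x) ∂(μ : Measure X) = c := by
        have h3 := (hpres.iterate r).map_eq
        conv_rhs => rw [hc, ← h3]
        rw [integral_map (hT.iterate r).measurable.aemeasurable]
        exact f.continuous.aestronglyMeasurable
      simp only [h2, sub_self] at h1
      refine h1.congr' ?_
      filter_upwards [eventually_gt_atTop 0] with n hn
      have : (n : ℝ) ≠ 0 := by positivity
      rw [Finset.sum_sub_distrib, Finset.sum_const, Finset.card_range, nsmul_eq_mul, sub_div,
        mul_div_cancel_left₀ _ this]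
    have hblock : Tendsto (fun q : ℕ => (∑ i ∈ Finset.range (N * q),
        (f (T^[i % N] (p (i / N))) - c)) / q) atTop (𝓝 0) := by
      have h1 := tendsto_finsetSum (Finset.range N) fun r _ => hp' r
      rw [Finset.sum_const_zero] at h1
      refine h1.congr fun q => ?_
      rw [← Finset.sum_div]
      congr 1
      rw [Finset.sum_comm]
      induction q with
      | zero => simp
      | succ q ih =>
        rw [Finset.sum_range_succ, ih, Nat.mul_succ, Finset.sum_range_add]
        congr 1
        refine Finset.sum_congr rfl fun r hr => ?_
        rw [Finset.mem_range] at hr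
        rw [Nat.mul_add_mod, Nat.mod_eq_of_lt hr, Nat.mul_add_div hN0, Nat.div_eq_of_lt hr,
          add_zero]
    have hbd : ∀ i, |f (T^[i % N] (p (i / N))) - c| ≤ ‖f‖ + |c| := fun i =>
      (abs_sub _ _).trans (add_le_add_left (f.norm_coe_le_norm _) _)
    have h2 := (tendsto_average_of_tendsto_block_average hN0 hbd hblock).add_const c
    rw [zero_add] at h2
    refine h2.congr' ?_
    filter_upwards [eventually_gt_atTop 0] with n hn
    have : (n : ℝ) ≠ 0 := by positivity
    rw [integral_avgDirac _ hn f.continuous, Finset.sum_sub_distrib, Finset.sum_const,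
      Finset.card_range, nsmul_eq_mul, sub_div, mul_div_cancel_left₀ _ this, sub_add_cancel]
  · refine Eventually.of_forall fun t => (sum_dist_segments_le hd hN0 p t).trans ?_
    calc C * (t / N : ℕ) ≤ C * (t / N) := by
          gcongr
          exact Nat.cast_div_le
      _ = C / N * t := by ring
      _ ≤ ε * t := by
          have : (0 : ℝ) < N := by exact_mod_cast hN0
          have : C / N ≤ ε := by
            rw [div_le_iff₀ this]
            rw [div_lt_iff₀ hε] at hN
            linarith
          gcongr

/-- Averages along a sequence and along a point tracing it up to permutations are close. -/
lemma eventually_lipClose_of_tendsto_iInf {x z : ℕ → X}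
    (h : Tendsto (fun n => ⨅ σ : Equiv.Perm (Fin n),
      (∑ i : Fin n, dist (x (i : ℕ)) (z ((σ i : Fin n) : ℕ))) / n) atTop (𝓝 0)) {ε : ℝ}
    (hε : 0 < ε) : ∀ᶠ n in atTop, LipClose ε (avgDirac z n) (avgDirac x n) := by
  filter_upwards [h.eventually (gt_mem_nhds hε), eventually_gt_atTop 0] with n hn hn0
  refine LipClose.symm fun f hf _ => le_trans (le_ciInf fun σ => ?_) hn.le
  have hn' : (0 : ℝ) < n := by exact_mod_cast hn0
  rw [integral_avgDirac _ hn0 hf.continuous, integral_avgDirac _ hn0 hf.continuous, ← sub_div,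
    abs_div, Nat.abs_cast]
  gcongr
  rw [Finset.sum_range, Finset.sum_range, ← Equiv.sum_comp σ (fun i : Fin n => f (z i)),
    ← Finset.sum_sub_distrib]
  refine (Finset.abs_sum_le_sum_abs _ _).trans (Finset.sum_le_sum fun i _ => ?_)
  simpa [Real.dist_eq] using hf.dist_le_mul (x i) (z (σ i))

end PseudoOrbits

section Realization

variable {X : Type*} [MetricSpace X] [TopologicalSpace.SeparableSpace X] [MeasurableSpace X]
  [BorelSpace X]

/-- A slowly varying sequence of invariant measures is followed by the averages along an asymptotic
average pseudo-orbit. -/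
lemma exists_isAAPO_following {T : X → X} (hT : Continuous T) {C : ℝ}
    (hd : ∀ a b : X, dist a b ≤ C) {ν : ℕ → ProbabilityMeasure X}
    (hinv : ∀ k, (ν k : Measure X).map T = ν k)
    (hν : ∀ ε > 0, ∀ᶠ k in atTop, LipClose ε (ν k) (ν (k + 1))) :
    ∃ x : ℕ → X, IsAAPO T x ∧ ∃ κ : ℕ → ℕ, Tendsto κ atTop atTop ∧
      (∀ ε > 0, ∀ᶠ n in atTop, LipClose ε (avgDirac x n) (ν (κ n))) ∧
      ∀ k, ∃ n ≥ k, κ n = k := by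
  have hpos : ∀ k : ℕ, (0 : ℝ) < 1 / ((k : ℝ) + 1) := fun k => by positivity
  choose y hy using fun k => exists_pseudoOrbit_of_invariant hT hd (hinv k)
    (eventually_lipClose (ν k) (hpos k)) (hpos k)
  choose N hN using fun k => eventually_atTop.1 (hy k)
  let s : ℕ → ℕ := fun k =>
    Nat.rec 0 (fun k m => m + (k + 1) * (m + N k + N (k + 1) + 1)) k
  have hs1 : ∀ k, s (k + 1) = s k + (k + 1) * (s k + N k + N (k + 1) + 1) := fun k => rfl
  have hs : StrictMono s := strictMono_nat_of_lt_succ fun k => by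
    rw [hs1]
    exact Nat.lt_add_of_pos_right (by positivity)
  have hx : ∀ k t, s k + t < s (k + 1) → glue s y (s k + t) = y k t :=
    fun k t h => glue_apply hs y h
  set x := glue s y
  set κ : ℕ → ℕ := glue s fun k _ => k with hκ_def
  have hκ : ∀ k t, s k + t < s (k + 1) → κ (s k + t) = k := fun k t h => glue_apply hs _ h
  have hκs : ∀ n, s (κ n) ≤ n ∧ n ≤ s (κ n + 1) := by
    intro n
    obtain ⟨k, t, rfl, h⟩ := exists_eq_add_of_strictMono hs rfl n
    rw [hκ k t h]
    exact ⟨Nat.le_add_right _ _, h.le⟩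
  have hκtop : Tendsto κ atTop atTop := by
    refine tendsto_atTop.2 fun k => ?_
    filter_upwards [eventually_ge_atTop (s (k + 1))] with n hn
    have := (hs.le_iff_le (a := k + 1) (b := κ n + 1)).1 (hn.trans (hκs n).2)
    omega
  have hprev : ∀ Q : ℕ → Prop, (∀ᶠ k in atTop, Q k) →
      ∀ᶠ n in atTop, ∃ k, κ n = k + 1 ∧ Q k := by
    intro Q hQ
    filter_upwards [((tendsto_sub_atTop_nat 1).comp hκtop).eventually hQ,
      hκtop.eventually (eventually_ge_atTop 1)] with n hn hn1
    exact ⟨κ n - 1, by omega, hn⟩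
  have hsmall : ∀ ε > 0, ∀ A : ℝ, ∀ᶠ k : ℕ in atTop, A * (1 / ((k : ℝ) + 1)) < ε := by
    intro ε hε A
    have h := (tendsto_one_div_add_atTop_nhds_zero_nat (𝕜 := ℝ)).const_mul A
    rw [mul_zero] at h
    exact h.eventually (gt_mem_nhds hε)
  refine ⟨x, ?_, κ, hκtop, ?_, fun k => ⟨s k, hs.le_apply, ?_⟩⟩
  · unfold IsAAPO
    rw [Metric.tendsto_nhds]
    intro ε hε
    have habs : ∀ a b : X, |dist a b - 0| ≤ C := fun a b => by
      rw [sub_zero, abs_of_nonneg dist_nonneg]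
      exact hd a b
    filter_upwards [hprev _ (hsmall ε hε (7 * C + 2)), eventually_gt_atTop 0] with n hn hn0
    obtain ⟨k, hk, hkε⟩ := hn
    have hn0' : (0 : ℝ) < n := by exact_mod_cast hn0
    have hest := abs_sum_sub_le_of_blocks (a := fun i => dist (T (x i)) (x (i + 1)))
      (b := fun k i => dist (T (y k i)) (y k (i + 1))) (c := fun _ => 0) (D := C) (N := N) (s := s)
      (fun _ _ => habs _ _) (fun _ _ => habs _ _)
      (fun k t ht => by
        simp only [sub_zero]
        rw [abs_of_nonneg (Finset.sum_nonneg fun _ _ => dist_nonneg)]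
        exact (hN k t ht).2)
      (fun k => (hs1 k).ge)
      (fun k i hi => by
        have h := hx k (i + 1) hi
        rw [← add_assoc] at h
        simp only [hx k i (by omega), h])
      (k := k) (δ := 0) (by simp) (n := n) (hk ▸ (hκs n).1) (hk ▸ (hκs n).2)
    simp only [sub_zero, add_zero] at hest
    rw [Real.dist_eq, sub_zero, abs_div, Nat.abs_cast, div_lt_iff₀ hn0']
    exact hest.trans_lt (by gcongr)
  · intro ε hε
    filter_upwards [hprev _ ((hsmall (ε / 2) (by positivity) 16).and (hν (ε / 2) (by positivity))),
      eventually_gt_atTop 0] with n hn hn0 f hf hf'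
    obtain ⟨k, hk, hkε, hkν⟩ := hn
    have hn0' : (0 : ℝ) < n := by exact_mod_cast hn0
    have hc : ∀ k, |∫ z, f z ∂(ν k : Measure X)| ≤ 1 := fun k => by
      have h := norm_integral_le_of_norm_le_const (μ := (ν k : Measure X)) (C := 1)
        (Eventually.of_forall fun z => (Real.norm_eq_abs (f z)).trans_le (hf' z))
      simpa using h
    have habs : ∀ k z, |f z - ∫ z, f z ∂(ν k : Measure X)| ≤ 2 := fun k z => by
      have h1 := abs_le.1 (hc k)
      have h2 := abs_le.1 (hf' z)
      rw [abs_le]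
      constructor <;> linarith
    have hest := abs_sum_sub_le_of_blocks (a := fun i => f (x i)) (b := fun k i => f (y k i))
      (c := fun k => ∫ z, f z ∂(ν k : Measure X)) (D := 2) (N := N) (s := s)
      (fun _ _ => habs _ _) (fun _ _ => habs _ _)
      (fun k t ht => by
        rcases Nat.eq_zero_or_pos t with rfl | ht0
        · simp
        have ht0' : (0 : ℝ) < t := by exact_mod_cast ht0
        have h := (hN k t ht).1.symm f hf hf'
        rwa [integral_avgDirac _ ht0 hf.continuous, div_sub' ht0'.ne', abs_div, Nat.abs_cast,
          div_le_iff₀ ht0', ← nsmul_eq_mul, ← Finset.card_range t, ← Finset.sum_const,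
          Finset.card_range, ← Finset.sum_sub_distrib] at h)
      (fun k => (hs1 k).ge)
      (fun k i hi => by simp only [hx k i (by omega)])
      (k := k) (hkν f hf hf') (n := n) (hk ▸ (hκs n).1) (hk ▸ (hκs n).2)
    rw [hk, integral_avgDirac _ hn0 hf.continuous, div_sub' hn0'.ne', abs_div, Nat.abs_cast,
      div_le_iff₀ hn0', ← nsmul_eq_mul, ← Finset.card_range n, ← Finset.sum_const,
      Finset.card_range, ← Finset.sum_sub_distrib]
    refine hest.trans ?_
    gcongr
    linarith
  · exact hκ k 0 (hs (Nat.lt_succ_self k))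

/-- A compact connected set of measures is the set of limit points of a slowly varying sequence of
its elements. -/
lemma exists_seq_lipClose_of_isPreconnected {V : Set (ProbabilityMeasure X)} (hne : V.Nonempty)
    (hcomp : IsCompact V) (hconn : IsPreconnected V) :
    ∃ ν : ℕ → ProbabilityMeasure X, (∀ k, ν k ∈ V) ∧
      (∀ ε > 0, ∀ᶠ k in atTop, LipClose ε (ν k) (ν (k + 1))) ∧
      ∀ μ ∈ V, ∀ S ∈ 𝓝 μ, ∃ᶠ k in atTop, ν k ∈ S := by
  have hpos : ∀ k : ℕ, (0 : ℝ) < 1 / ((k : ℝ) + 1) := fun k => by positivity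
  have : Nonempty V := hne.to_subtype
  have : CompactSpace V := isCompact_iff_compactSpace.1 hcomp
  let e := TopologicalSpace.denseSeq V
  let R : ℕ → ProbabilityMeasure X → ProbabilityMeasure X → Prop := fun j a b =>
    a ∈ V ∧ b ∈ V ∧ LipClose (1 / ((j : ℝ) + 1)) a b
  have hR : ∀ j, ∀ a ∈ V, ∀ b ∈ V, Relation.ReflTransGen (R j) a b := by
    intro j a ha b hb
    refine hconn.induction₂' (Relation.ReflTransGen (R j)) (fun a ha => ?_)
      (fun _ _ _ _ _ _ h h' => h.trans h') ha hb
    filter_upwards [self_mem_nhdsWithin, (eventually_lipClose a (hpos j)).filter_mono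
      nhdsWithin_le_nhds] with b hb hab
    exact ⟨.single ⟨ha, hb, hab⟩, .single ⟨hb, ha, hab.symm⟩⟩
  obtain ⟨ν, hνV, hν, hνq⟩ := exists_seq_of_reflTransGen (R := R) (q := fun j => (e j.unpair.1 : _))
    (fun j => ⟨Subtype.coe_prop _, Subtype.coe_prop _, LipClose.refl (hpos j).le _⟩)
    (fun j => hR j _ (Subtype.coe_prop _) _ (Subtype.coe_prop _))
  refine ⟨ν, fun k => ?_, fun ε hε => ?_, fun μ hμ S hS => frequently_atTop.2 fun m => ?_⟩
  · obtain ⟨_, hk, -⟩ := hνV k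
    exact hk
  · obtain ⟨j, hj⟩ := exists_nat_one_div_lt hε
    filter_upwards [hν j] with i hi
    obtain ⟨j', hj', -, -, h⟩ := hi
    exact h.mono ((one_div_le_one_div_of_le (by positivity) (by gcongr)).trans hj.le)
  · obtain ⟨_, hnS, n, rfl⟩ := mem_closure_iff_nhds.1
      (TopologicalSpace.denseRange_denseSeq V ⟨μ, hμ⟩) _ (continuous_subtype_val.continuousAt hS)
    obtain ⟨i, hi, hi'⟩ := hνq (Nat.pair n m)
    refine ⟨i, (Nat.right_le_pair n m).trans hi, ?_⟩
    rw [hi', Nat.unpair_pair]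
    exact hnS

end Realization

theorem stmt18 {X : Type*} [MetricSpace X] [TopologicalSpace.SeparableSpace X]
    [CompleteSpace X] [MeasurableSpace X] [BorelSpace X]
    (hd : ∃ C, ∀ a b : X, dist a b ≤ C)
    (T : X → X) (hT : Continuous T) (hsh : AOASP T)
    (V : Set (ProbabilityMeasure X)) (hV1 : V.Nonempty) (hV2 : IsCompact V)
    (hV3 : IsPreconnected V)
    (hVinv : ∀ μ ∈ V, μ.toMeasure.map T = μ.toMeasure) :
    ∃ x : X, limitMeasures (fun i => T^[i] x) = V := by
  obtain ⟨C, hC⟩ := hd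
  obtain ⟨ν, hνV, hν, hνd⟩ := exists_seq_lipClose_of_isPreconnected hV1 hV2 hV3
  obtain ⟨x, hx, κ, hκ, hxν, hκs⟩ :=
    exists_isAAPO_following hT hC (fun k => hVinv _ (hνV k)) hν
  obtain ⟨z, hz⟩ := hsh x hx
  have hzν : ∀ ε > 0, ∀ᶠ n in atTop, LipClose ε (avgDirac (fun i => T^[i] z) n) (ν (κ n)) := by
    intro ε hε
    filter_upwards [eventually_lipClose_of_tendsto_iInf (z := fun i => T^[i] z) hz (half_pos hε),
      hxν (ε / 2) (half_pos hε)] with n h1 h2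
    simpa using h1.trans h2
  refine ⟨z, Set.Subset.antisymm ?_ ?_⟩
  · rintro μ ⟨φ, hφ, hμ⟩
    refine hV2.isClosed.mem_of_tendsto (b := atTop) (f := fun k => ν (κ (φ k)))
      (tendsto_of_eventually_lipClose fun ε hε => ?_) (Eventually.of_forall fun k => hνV _)
    filter_upwards [hφ.tendsto_atTop.eventually (hzν (ε / 2) (half_pos hε)),
      hμ.eventually (eventually_lipClose μ (half_pos hε))] with k h1 h2
    simpa using h1.symm.trans h2.symm
  · intro μ hμ
    have hfreq : ∀ j : ℕ, ∃ᶠ n in atTop,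
        LipClose (1 / ((j : ℝ) + 1)) (avgDirac (fun i => T^[i] z) n) μ := by
      intro j
      have hj : (0 : ℝ) < 1 / ((j : ℝ) + 1) := by positivity
      have h1 : ∃ᶠ n in atTop, LipClose (1 / ((j : ℝ) + 1) / 2) μ (ν (κ n)) := by
        rw [frequently_atTop]
        intro m
        obtain ⟨k, hk, hkμ⟩ := frequently_atTop.1
          (hνd μ hμ _ (eventually_lipClose μ (half_pos hj))) m
        obtain ⟨n, hn, rfl⟩ := hκs k
        exact ⟨n, hk.trans hn, hkμ⟩
      refine (h1.and_eventually (hzν _ (half_pos hj))).mono fun n hn => ?_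
      simpa using hn.2.trans hn.1.symm
    obtain ⟨φ, hφ, hφμ⟩ := extraction_forall_of_frequently hfreq
    refine ⟨φ, hφ, tendsto_of_eventually_lipClose fun ε hε => ?_⟩
    filter_upwards [(tendsto_one_div_add_atTop_nhds_zero_nat (𝕜 := ℝ)).eventually
      (gt_mem_nhds hε)] with k hk
    exact (hφμ k).mono hk.le
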